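/- Let A and B be chain complexes over k, let f : A → B and g : B → A be chain maps with fg = 1_B, and let h : A → A be a degree +1 map with d_A h + h d_A = gf − 1_A (no annihilation conditions assumed). Set h' = (gf − 1_A) h (gf − 1_A) and h'' = −h' d_A h'. Then (f, g, h'') is a contraction: d_A h'' + h'' d_A = gf − 1_A, fh'' = 0, h''g = 0, and h''h'' = 0. -/

import Mathlib

open scoped TensorProduct DirectSum

/-- A `ℤ`-graded `k`-module. -/
structure GradedModule (k : Type) [CommRing k] where
  M : ℤ → Type
  [acg : ∀ i, AddCommGroup (M i)]
  [mod : ∀ i, Module k (M i)]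

attribute [instance] GradedModule.acg GradedModule.mod

variable {k : Type} [CommRing k]

/-- Graded `k`-linear maps of degree `r`. -/
abbrev GMap (A B : GradedModule k) (r : ℤ) := ∀ i : ℤ, A.M i →ₗ[k] B.M (i + r)

/-- Transport along an equality of degrees. -/
def GradedModule.cast (A : GradedModule k) {i j : ℤ} (h : i = j) : A.M i ≃ₗ[k] A.M j := by
  subst h; exact LinearEquiv.refl k (A.M i)

/-- Recast the degree of a graded map. -/
def GMap.cast {A B : GradedModule k} {r s : ℤ} (h : r = s) (f : GMap A B r) : GMap A B s :=
  fun i => (B.cast (by rw [h])).toLinearMap ∘ₗ f i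

/-- Recast the degree of a graded map, with the degree equation discharged automatically. -/
def dcast {A B : GradedModule k} {r s : ℤ} (f : GMap A B r) (h : r = s := by norm_num) :
    GMap A B s := GMap.cast h f

/-- Composition of graded maps (`gcomp g f = g ∘ f`, so `f` acts first). -/
def gcomp {A B C : GradedModule k} {r s : ℤ} (g : GMap B C s) (f : GMap A B r) :
    GMap A C (r + s) :=
  fun i => (C.cast (add_assoc i r s)).toLinearMap ∘ₗ g (i + r) ∘ₗ f i

/-- The identity graded map. -/
def gid (A : GradedModule k) : GMap A A 0 := fun i => (A.cast (add_zero i).symm).toLinearMap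

/-- The sign `(-1)^r`. -/
def gsign (r : ℤ) : ℤ := (-1) ^ r.natAbs

/-- An (unbounded) chain complex of `k`-modules: the differential has degree `-1`. -/
structure Cplx (k : Type) [CommRing k] extends GradedModule k where
  d : GMap toGradedModule toGradedModule (-1)
  d_sq : gcomp d d = 0

/-- The differential `∂(f) = d∘f - (-1)^{|f|} f∘d` on graded maps between chain complexes. -/
def gdiff {A B : Cplx k} {r : ℤ} (f : GMap A.toGradedModule B.toGradedModule r) :
    GMap A.toGradedModule B.toGradedModule (r - 1) :=
  GMap.cast (by ring) (gcomp B.d f) - gsign r • GMap.cast (by ring) (gcomp f A.d)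

/-- A perturbation of the chain complex `A`: a degree `-1` map `t` with `(d+t)² = 0`. -/
def IsPerturbation (A : Cplx k) (t : GMap A.toGradedModule A.toGradedModule (-1)) : Prop :=
  gcomp (A.d + t) (A.d + t) = 0

/-- A contraction (SDR-data) of chain complexes. -/
structure Contraction (A B : Cplx k) where
  f : GMap A.toGradedModule B.toGradedModule 0
  g : GMap B.toGradedModule A.toGradedModule 0
  h : GMap A.toGradedModule A.toGradedModule 1
  f_chain : gdiff f = 0
  g_chain : gdiff g = 0
  fg : gcomp f g = gid B.toGradedModule
  homotopy : gdiff h = dcast (gcomp g f) - dcast (gid A.toGradedModule)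
  fh : gcomp f h = 0
  hg : gcomp h g = 0
  hh : gcomp h h = 0

/-- The map between total products induced by a graded map. -/
def GMap.total {A B : GradedModule k} {r : ℤ} (f : GMap A B r) :
    (∀ i, A.M i) →ₗ[k] (∀ i, B.M i) :=
  LinearMap.pi fun j =>
    (B.cast (sub_add_cancel j r)).toLinearMap ∘ₗ f (j - r) ∘ₗ LinearMap.proj (j - r)

theorem GradedModule.cast_rfl (A : GradedModule k) {i : ℤ} (h : i = i) (x : A.M i) :
    A.cast h x = x := rfl

theorem GradedModule.cast_cast (A : GradedModule k) {i j l : ℤ} (h : i = j) (h' : j = l)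
    (x : A.M i) : A.cast h' (A.cast h x) = A.cast (h.trans h') x := by
  subst h h'; rfl

namespace GMap

variable {A B C : GradedModule k} {r s : ℤ}

theorem total_apply (f : GMap A B r) (x : ∀ i, A.M i) {i j : ℤ} (h : i + r = j) :
    f.total x j = B.cast h (f i (x i)) := by
  obtain rfl : i = j - r := by omega
  rfl

theorem total_injective : Function.Injective (total : GMap A B r → _) := by
  intro f g hfg
  funext i
  ext x
  have h := congrFun (LinearMap.congr_fun hfg (Pi.single i x)) (i + r)
  simpa [total_apply _ _ (rfl : i + r = i + r)] using h

theorem total_neg (f : GMap A B r) : (-f).total = -f.total := by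
  ext x j
  simp [total]

theorem total_sub (f g : GMap A B r) : (f - g).total = f.total - g.total := by
  ext x j
  simp [total]

theorem total_zsmul (n : ℤ) (f : GMap A B r) : (n • f).total = n • f.total := by
  ext x j
  simp [total]

theorem total_zero : (0 : GMap A B r).total = 0 := by
  ext x j
  simp [total]

theorem total_cast (h : r = s) (f : GMap A B r) : (GMap.cast h f).total = f.total := by
  subst h
  rfl

theorem total_dcast (f : GMap A B r) (h : r = s) : (dcast f h).total = f.total :=
  total_cast h f

theorem total_gcomp (g : GMap B C s) (f : GMap A B r) :
    (gcomp g f).total = g.total ∘ₗ f.total := by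
  refine LinearMap.ext fun x => funext fun j => ?_
  have h : j - s - r + (r + s) = j := by omega
  have h' : j - s - r + r + s = j := by omega
  rw [total_apply _ _ h, LinearMap.comp_apply, total_apply _ _ h', total_apply _ _ rfl]
  simp only [gcomp, LinearMap.comp_apply, LinearEquiv.coe_coe, GradedModule.cast_cast,
    GradedModule.cast_rfl]

theorem total_gid : (gid A).total = LinearMap.id := by
  refine LinearMap.ext fun x => funext fun j => ?_
  rw [total_apply _ _ (add_zero j)]
  simp only [gid, LinearEquiv.coe_coe, GradedModule.cast_cast, GradedModule.cast_rfl,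
    LinearMap.id_apply]

end GMap

theorem Cplx.total_d_sq (A : Cplx k) : A.d.total ∘ₗ A.d.total = 0 := by
  rw [← GMap.total_gcomp, A.d_sq, GMap.total_zero]

theorem total_gdiff {A B : Cplx k} {r : ℤ} (f : GMap A.toGradedModule B.toGradedModule r) :
    (gdiff f).total = B.d.total ∘ₗ f.total - gsign r • (f.total ∘ₗ A.d.total) := by
  simp only [gdiff, GMap.total_sub, GMap.total_zsmul, GMap.total_cast, GMap.total_gcomp]

/-- If `p` satisfies `p * p = -p`, commutes with `d`, and is null-homotopic through `h`, then
`-h' * d * h'` with `h' = p * h * p` is a square-zero null-homotopy of `p`. -/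
theorem nullHomotopy_improvement {R : Type*} [Ring R] {d p h h' : R} (hd : d * d = 0)
    (hdp : d * p = p * d) (hpp : p * p = -p) (hh : d * h + h * d = p) (hh' : h' = p * (h * p)) :
    d * -(h' * (d * h')) + -(h' * (d * h')) * d = p ∧
      (h' * (d * h')) * (h' * (d * h')) = 0 := by
  have hp_left : p * h' = -h' := by rw [hh', ← mul_assoc, hpp, neg_mul]
  have hp_right : h' * p = -h' := by rw [hh', mul_assoc, mul_assoc, hpp, mul_neg, mul_neg]
  have hhom : d * h' = p - h' * d := by
    rw [eq_sub_iff_add_eq]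
    calc d * h' + h' * d = (d * p) * h * p + p * h * (p * d) := by rw [hh']; noncomm_ring
      _ = (p * d) * h * p + p * h * (d * p) := by rw [hdp]
      _ = p * (d * h + h * d) * p := by noncomm_ring
      _ = p := by rw [hh, hpp, neg_mul, hpp, neg_neg]
  have hdhd : d * h' * d = d * p := by rw [hhom, sub_mul, mul_assoc, hd, mul_zero, sub_zero, hdp]
  constructor
  · calc d * -(h' * (d * h')) + -(h' * (d * h')) * d
        = -(d * h' * d * h' + h' * (d * h' * d)) := by noncomm_ring
      _ = -(d * (p * h') + h' * p * d) := by rw [hdhd, mul_assoc d p, hdp, mul_assoc h' p]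
      _ = d * h' + h' * d := by rw [hp_left, hp_right]; noncomm_ring
      _ = p := by rw [hhom, sub_add_cancel]
  · have hcomm : d * (h' * h') = h' * h' * d := by
      calc d * (h' * h') = p * h' - h' * (d * h') := by
            rw [← mul_assoc, hhom, sub_mul, mul_assoc, ← hhom]
        _ = -h' - (h' * p - h' * h' * d) := by rw [hp_left, hhom]; noncomm_ring
        _ = h' * h' * d := by rw [hp_right]; noncomm_ring
    calc (h' * (d * h')) * (h' * (d * h')) = h' * (d * (h' * h')) * d * h' := by noncomm_ring
      _ = h' * (h' * h' * (d * d)) * h' := by rw [hcomm]; noncomm_ring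
      _ = 0 := by rw [hd]; simp

/-- Given chain maps `f : A → B`, `g : B → A` with `f∘g = 1_B` and a degree `+1` map `h` with
`d∘h + h∘d = g∘f - 1` (no annihilation conditions assumed), setting
`h' = (g∘f - 1)∘h∘(g∘f - 1)` and `h'' = -h'∘d∘h'`, the data `(f, g, h'')` is a contraction:
`d∘h'' + h''∘d = g∘f - 1`, `f∘h'' = 0`, `h''∘g = 0` and `h''∘h'' = 0`. -/
theorem contraction_from_homotopy_equivalence (A B : Cplx k)
    (f : GMap A.toGradedModule B.toGradedModule 0)
    (g : GMap B.toGradedModule A.toGradedModule 0)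
    (h : GMap A.toGradedModule A.toGradedModule 1)
    (hf : gdiff f = 0) (hg : gdiff g = 0)
    (hfg : gcomp f g = gid B.toGradedModule)
    (hh : gdiff h = dcast (gcomp g f) - dcast (gid A.toGradedModule))
    (h' : GMap A.toGradedModule A.toGradedModule 1)
    (hh' : h' = dcast (gcomp (dcast (gcomp g f) - gid A.toGradedModule)
        (gcomp h (dcast (gcomp g f) - gid A.toGradedModule))))
    (h'' : GMap A.toGradedModule A.toGradedModule 1)
    (hh'' : h'' = - dcast (gcomp h' (gcomp A.d h'))) :
    gdiff h'' = dcast (gcomp g f) - dcast (gid A.toGradedModule) ∧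
    gcomp f h'' = 0 ∧ gcomp h'' g = 0 ∧ gcomp h'' h'' = 0 := by
  have hdf := congrArg GMap.total hf
  have hdg := congrArg GMap.total hg
  have hfgt := congrArg GMap.total hfg
  have hht := congrArg GMap.total hh
  have hh't := congrArg GMap.total hh'
  have hh''t := congrArg GMap.total hh''
  have s0 : gsign 0 = 1 := rfl
  have s1 : gsign 1 = -1 := rfl
  simp only [total_gdiff, GMap.total_gcomp, GMap.total_dcast, GMap.total_sub, GMap.total_neg,
    GMap.total_gid, GMap.total_zero, s0, s1, one_smul, neg_smul, sub_neg_eq_add]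
    at hdf hdg hfgt hht hh't hh''t
  rw [sub_eq_zero] at hdf hdg
  have hd := A.total_d_sq
  have inj {C D : GradedModule k} {r : ℤ} {u v : GMap C D r} (e : u.total = v.total) : u = v :=
    GMap.total_injective e
  set d := A.d.total
  set F := f.total
  set G := g.total
  set p : Module.End k (∀ i, A.M i) := G ∘ₗ F - LinearMap.id with hp
  have hFp : F ∘ₗ p = 0 := by
    rw [hp, LinearMap.comp_sub, ← LinearMap.comp_assoc, hfgt, LinearMap.id_comp,
      LinearMap.comp_id, sub_self]
  have hpG : p ∘ₗ G = 0 := by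
    rw [hp, LinearMap.sub_comp, LinearMap.comp_assoc, hfgt, LinearMap.id_comp,
      LinearMap.comp_id, sub_self]
  have hpp : p * p = -p := by
    change p ∘ₗ p = -p
    nth_rw 1 [hp]
    rw [LinearMap.sub_comp, LinearMap.comp_assoc, hFp, LinearMap.comp_zero, LinearMap.id_comp,
      zero_sub]
  have hdp : d * p = p * d := by
    change d ∘ₗ p = p ∘ₗ d
    rw [hp, LinearMap.comp_sub, LinearMap.sub_comp, ← LinearMap.comp_assoc, hdg,
      LinearMap.comp_assoc, hdf, LinearMap.comp_assoc, LinearMap.comp_id, LinearMap.id_comp]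
  have hFh' : F ∘ₗ h'.total = 0 := by
    rw [hh't, ← LinearMap.comp_assoc, hFp, LinearMap.zero_comp]
  have hh'G : h'.total ∘ₗ G = 0 := by
    rw [hh't, LinearMap.comp_assoc, LinearMap.comp_assoc, hpG, LinearMap.comp_zero,
      LinearMap.comp_zero]
  obtain ⟨hhom, hsq⟩ := nullHomotopy_improvement hd hdp hpp hht hh't
  refine ⟨inj ?_, inj ?_, inj ?_, inj ?_⟩
  · simp only [total_gdiff, GMap.total_sub, GMap.total_dcast, GMap.total_gcomp, GMap.total_gid,
      s1, neg_smul, one_smul, sub_neg_eq_add, hh''t]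
    exact hhom
  · rw [GMap.total_gcomp, GMap.total_zero, hh''t, LinearMap.comp_neg, ← LinearMap.comp_assoc,
      hFh', LinearMap.zero_comp, neg_zero]
  · rw [GMap.total_gcomp, GMap.total_zero, hh''t, LinearMap.neg_comp, LinearMap.comp_assoc,
      LinearMap.comp_assoc, hh'G, LinearMap.comp_zero, LinearMap.comp_zero, neg_zero]
  · rw [GMap.total_gcomp, GMap.total_zero, hh''t, LinearMap.neg_comp, LinearMap.comp_neg, neg_neg]
    exact hsq
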